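/- Let ξ_i^a, η_i^a ∈ A (1 ≤ i ≤ N, 1 ≤ a ≤ r) and define the rank-one-block matrices F^{ab} by (F^{ab})_{ij} = ξ_i^b η_j^a. Suppose the N×N matrix L over A satisfies, for some N²×N² matrix R over A, the trigonometric ECM relations: {L ⊗, L} = [R, L ⊗ 1] − [R^π, 1 ⊗ L], {L ⊗, F^{ab}} = −[R^π, 1 ⊗ F^{ab}] + [C, 1 ⊗ F^{ab}], and {F^{ab} ⊗, F^{cd}} = (δ_{ad} F^{cb} ⊗ 1 − δ_{cb} 1 ⊗ F^{ad})·C for all a, b, c, d. Define F^{ab}_{n,0} = Tr(L^n F^{ab}). Then the generators F^{ab}_{n,0} close an exact Yangian (quadratically deformed current) algebra: for all n, m ≥ 0 and all a, b, c, d, {F^{ab}_{n,0}, F^{cd}_{m,0}} = δ_{ad} F^{cb}_{n+m,0} − δ_{cb} F^{ad}_{n+m,0} + Σ_{i=1}^n ( F^{cb}_{n+m−i,0} F^{ad}_{i−1,0} − F^{cb}_{n−i,0} F^{ad}_{m+i−1,0} ) + Σ_{i=1}^m ( F^{cb}_{n+i−1,0} F^{ad}_{m−i,0} − F^{cb}_{i−1,0}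 F^{ad}_{m+n−i,0} ). -/

import Mathlib

open Matrix Kronecker

structure PoissonBr (A : Type*) [CommRing A] where
  br : A → A → A
  add_left : ∀ x y z, br (x + y) z = br x z + br y z
  add_right : ∀ x y z, br x (y + z) = br x y + br x z
  antisymm : ∀ x y, br x y = -br y x
  leibniz : ∀ x y z, br x (y * z) = br x y * z + y * br x z

/-- The matrix `{M ⊗, M'}` of pairwise brackets of entries. -/
def matBr {A : Type*} [CommRing A] {N : ℕ} (P : PoissonBr A)
    (M M' : Matrix (Fin N) (Fin N) A) :
    Matrix (Fin N × Fin N) (Fin N × Fin N) A :=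
  fun p q => P.br (M p.1 q.1) (M' p.2 q.2)

/-- `R^π`, the permuted matrix. -/
def piSwap {A : Type*} [CommRing A] {N : ℕ}
    (R : Matrix (Fin N × Fin N) (Fin N × Fin N) A) :
    Matrix (Fin N × Fin N) (Fin N × Fin N) A :=
  fun p q => R (p.2, p.1) (q.2, q.1)

/-- The Casimir matrix `C`, with entries `C_{(i,k),(j,l)} = δ_{il} δ_{kj}`. -/
def casC {A : Type*} [CommRing A] {N : ℕ} :
    Matrix (Fin N × Fin N) (Fin N × Fin N) A :=
  fun p q => if p.1 = q.2 ∧ p.2 = q.1 then 1 else 0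

/-- Matrix commutator. -/
def mComm {A : Type*} [CommRing A] {n : Type*} [Fintype n] (X Y : Matrix n n A) :
    Matrix n n A := X * Y - Y * X

/-- The rank-one matrices `F^{ab}` with entries `(F^{ab})_{ij} = ξ_i^b η_j^a`. -/
def Fab {A : Type*} [CommRing A] {N r : ℕ} (ξ η : Fin N → Fin r → A)
    (a b : Fin r) : Matrix (Fin N) (Fin N) A :=
  Matrix.of fun i j => ξ i b * η j a

namespace PoissonBr

variable {A : Type*} [CommRing A] (P : PoissonBr A)

theorem mul_left (x y z : A) : P.br (x * y) z = P.br x z * y + x * P.br y z := by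
  rw [P.antisymm, P.leibniz, P.antisymm x, P.antisymm y]
  ring

theorem one_right (x : A) : P.br x 1 = 0 := by
  simpa using P.leibniz x 1 1

theorem zero_right (x : A) : P.br x 0 = 0 := by
  simpa using P.add_right x 0 0

theorem zero_left (x : A) : P.br 0 x = 0 := by
  rw [P.antisymm, P.zero_right, neg_zero]

theorem one_left (x : A) : P.br 1 x = 0 := by
  rw [P.antisymm, P.one_right, neg_zero]

theorem sum_left {ι : Type*} (s : Finset ι) (f : ι → A) (x : A) :
    P.br (∑ i ∈ s, f i) x = ∑ i ∈ s, P.br (f i) x :=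
  map_sum (AddMonoidHom.mk' (fun y => P.br y x) fun y z => P.add_left y z x) f s

theorem sum_right {ι : Type*} (s : Finset ι) (f : ι → A) (x : A) :
    P.br x (∑ i ∈ s, f i) = ∑ i ∈ s, P.br x (f i) :=
  map_sum (AddMonoidHom.mk' (P.br x) (P.add_right x)) f s

end PoissonBr

section ConjSum

variable {B : Type*} [Ring B]

/-- The sum `∑_{k < n} x ^ k * y * x ^ (n - 1 - k)`: the value at `x ^ n` of a derivation
sending `x` to `y`. -/
def conjSum (n : ℕ) (x y : B) : B :=
  ∑ k ∈ Finset.range n, x ^ k * y * x ^ (n - 1 - k)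

theorem conjSum_zero (x y : B) : conjSum 0 x y = 0 := by simp [conjSum]

theorem conjSum_succ (n : ℕ) (x y : B) :
    conjSum (n + 1) x y = conjSum n x y * x + x ^ n * y := by
  rw [conjSum, conjSum, Finset.sum_range_succ, Finset.sum_mul]
  congr 1
  · refine Finset.sum_congr rfl fun k hk => ?_
    have hk := Finset.mem_range.1 hk
    rw [mul_assoc (x ^ k * y), ← pow_succ]
    congr 2
    omega
  · simp

theorem conjSum_add (n : ℕ) (x y z : B) :
    conjSum n x (y + z) = conjSum n x y + conjSum n x z := by
  simp [conjSum, mul_add, add_mul, Finset.sum_add_distrib]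

theorem conjSum_sub (n : ℕ) (x y z : B) :
    conjSum n x (y - z) = conjSum n x y - conjSum n x z := by
  simp [conjSum, mul_sub, sub_mul, Finset.sum_sub_distrib]

theorem conjSum_commutator_self (n : ℕ) (x y : B) :
    conjSum n x (y * x - x * y) = y * x ^ n - x ^ n * y := by
  induction n with
  | zero => simp [conjSum_zero]
  | succ n ih =>
    rw [conjSum_succ, ih, pow_succ]
    noncomm_ring

theorem conjSum_commutator_of_commute {x z : B} (h : Commute x z) (n : ℕ) (y : B) :
    conjSum n x (y * z - z * y) = conjSum n x y * z - z * conjSum n x y := by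
  simp only [conjSum, Finset.sum_mul, Finset.mul_sum, ← Finset.sum_sub_distrib]
  refine Finset.sum_congr rfl fun k _ => ?_
  have h₁ := (h.pow_left k).eq
  have h₂ := (h.pow_left (n - 1 - k)).eq
  rw [mul_assoc _ _ z, h₂, ← mul_assoc z, ← mul_assoc z, ← h₁]
  noncomm_ring

end ConjSum

theorem sum_Icc_one_eq_sum_range {M : Type*} [AddCommMonoid M] (f : ℕ → M) (n : ℕ) :
    ∑ i ∈ Finset.Icc 1 n, f i = ∑ k ∈ Finset.range n, f (k + 1) := by
  induction n with
  | zero => simp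
  | succ n ih => rw [Finset.sum_Icc_succ_top (by omega), ih, Finset.sum_range_succ]

section TensorSquare

variable {A : Type*} [CommRing A] {N : ℕ}

/-- The embedding `M ↦ M ⊗ 1`. -/
def kronLeft : Matrix (Fin N) (Fin N) A →+* Matrix (Fin N × Fin N) (Fin N × Fin N) A where
  toFun M := M ⊗ₖ 1
  map_one' := one_kronecker_one
  map_zero' := zero_kronecker _
  map_add' _ _ := add_kronecker _ _ _
  map_mul' X Y := by rw [← mul_kronecker_mul, one_mul]

/-- The embedding `M ↦ 1 ⊗ M`. -/
def kronRight : Matrix (Fin N) (Fin N) A →+* Matrix (Fin N × Fin N) (Fin N × Fin N) A where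
  toFun M := 1 ⊗ₖ M
  map_one' := one_kronecker_one
  map_zero' := kronecker_zero _
  map_add' _ _ := kronecker_add _ _ _
  map_mul' X Y := by rw [← mul_kronecker_mul, one_mul]

theorem kronLeft_apply (M : Matrix (Fin N) (Fin N) A) : kronLeft M = M ⊗ₖ 1 := rfl

theorem kronRight_apply (M : Matrix (Fin N) (Fin N) A) : kronRight M = 1 ⊗ₖ M := rfl

theorem commute_kronLeft_kronRight (X Y : Matrix (Fin N) (Fin N) A) :
    Commute (kronLeft X) (kronRight Y) := by
  simp [Commute, SemiconjBy, kronLeft_apply, kronRight_apply, ← mul_kronecker_mul]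

theorem kronLeft_mul_apply (X : Matrix (Fin N) (Fin N) A)
    (Q : Matrix (Fin N × Fin N) (Fin N × Fin N) A) (p q : Fin N × Fin N) :
    (kronLeft X * Q) p q = ∑ j, X p.1 j * Q (j, p.2) q := by
  simp [kronLeft_apply, mul_apply, Fintype.sum_prod_type, kroneckerMap_apply, one_apply]

theorem mul_kronLeft_apply (X : Matrix (Fin N) (Fin N) A)
    (Q : Matrix (Fin N × Fin N) (Fin N × Fin N) A) (p q : Fin N × Fin N) :
    (Q * kronLeft X) p q = ∑ j, Q p (j, q.2) * X j q.1 := by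
  simp [kronLeft_apply, mul_apply, Fintype.sum_prod_type, kroneckerMap_apply, one_apply]

theorem kronRight_mul_apply (X : Matrix (Fin N) (Fin N) A)
    (Q : Matrix (Fin N × Fin N) (Fin N × Fin N) A) (p q : Fin N × Fin N) :
    (kronRight X * Q) p q = ∑ j, X p.2 j * Q (p.1, j) q := by
  simp [kronRight_apply, mul_apply, Fintype.sum_prod_type, kroneckerMap_apply, one_apply]

theorem mul_kronRight_apply (X : Matrix (Fin N) (Fin N) A)
    (Q : Matrix (Fin N × Fin N) (Fin N × Fin N) A) (p q : Fin N × Fin N) :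
    (Q * kronRight X) p q = ∑ j, Q p (q.1, j) * X j q.2 := by
  simp [kronRight_apply, mul_apply, Fintype.sum_prod_type, kroneckerMap_apply, one_apply]

theorem trace_kronLeft_mul_kronRight_mul_casC (U V : Matrix (Fin N) (Fin N) A) :
    (kronLeft U * (kronRight V * casC)).trace = (U * V).trace := by
  simp only [trace, diag_apply, kronLeft_mul_apply, kronRight_mul_apply, Fintype.sum_prod_type]
  simp [casC, mul_apply, ite_and]

theorem trace_kronLeft_mul_mComm_kronRight (U V : Matrix (Fin N) (Fin N) A)
    (Q : Matrix (Fin N × Fin N) (Fin N × Fin N) A) :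
    (kronLeft U * mComm Q (kronRight V)).trace = 0 := by
  rw [mComm, mul_sub, trace_sub, ← mul_assoc, trace_mul_comm (kronLeft U * Q), ← mul_assoc,
    ← mul_assoc, (commute_kronLeft_kronRight U V).eq, sub_self]

theorem trace_mComm (X Y : Matrix (Fin N × Fin N) (Fin N × Fin N) A) :
    (mComm X Y).trace = 0 := by
  rw [mComm, trace_sub, trace_mul_comm, sub_self]

theorem trace_mul_mComm_casC_kronRight (U V G : Matrix (Fin N) (Fin N) A) :
    (kronLeft U * (kronRight V * mComm casC (kronRight G))).trace =
      (U * (G * V)).trace - (U * (V * G)).trace := by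
  have h : (kronLeft U * (kronRight V * (casC * kronRight G))).trace =
      (kronLeft U * (kronRight (G * V) * casC)).trace := by
    rw [← mul_assoc, ← mul_assoc, trace_mul_comm, ← mul_assoc, ← mul_assoc,
      ← (commute_kronLeft_kronRight U G).eq, map_mul]
    simp only [mul_assoc]
  rw [mComm, mul_sub, mul_sub, trace_sub, h, ← mul_assoc (kronRight V), ← map_mul,
    trace_kronLeft_mul_kronRight_mul_casC, trace_kronLeft_mul_kronRight_mul_casC]

theorem trace_mul_mComm_casC_kronLeft (U V F : Matrix (Fin N) (Fin N) A) :
    (kronLeft U * (kronRight V * mComm casC (kronLeft F))).trace =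
      (F * (U * V)).trace - (U * (F * V)).trace := by
  have h : (kronLeft U * (kronRight V * (casC * kronLeft F))).trace =
      (kronLeft (F * U) * (kronRight V * casC)).trace := by
    rw [← mul_assoc, ← mul_assoc, trace_mul_comm, map_mul]
    simp only [mul_assoc]
  rw [mComm, mul_sub, mul_sub, trace_sub, h, ← mul_assoc (kronRight V),
    ← (commute_kronLeft_kronRight F V).eq, mul_assoc, ← mul_assoc (kronLeft U), ← map_mul,
    trace_kronLeft_mul_kronRight_mul_casC, trace_kronLeft_mul_kronRight_mul_casC,
    mul_assoc, mul_assoc]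

theorem piSwap_mul (X Y : Matrix (Fin N × Fin N) (Fin N × Fin N) A) :
    piSwap (X * Y) = piSwap X * piSwap Y :=
  (submatrix_mul_equiv X Y Prod.swap (Equiv.prodComm _ _) Prod.swap).symm

theorem piSwap_piSwap (X : Matrix (Fin N × Fin N) (Fin N × Fin N) A) :
    piSwap (piSwap X) = X := rfl

theorem piSwap_casC : piSwap (casC : Matrix (Fin N × Fin N) (Fin N × Fin N) A) = casC := by
  ext p q
  simp [piSwap, casC, and_comm]

theorem piSwap_kronRight (X : Matrix (Fin N) (Fin N) A) :
    piSwap (kronRight X) = kronLeft X := by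
  ext p q
  simp [piSwap, kronLeft_apply, kronRight_apply, kroneckerMap_apply, mul_comm]

theorem piSwap_mComm (X Y : Matrix (Fin N × Fin N) (Fin N × Fin N) A) :
    piSwap (mComm X Y) = mComm (piSwap X) (piSwap Y) := by
  rw [mComm, mComm, ← piSwap_mul, ← piSwap_mul]
  rfl

variable (P : PoissonBr A)

theorem matBr_eq_neg_piSwap (X Y : Matrix (Fin N) (Fin N) A) :
    matBr P X Y = -piSwap (matBr P Y X) := by
  ext p q
  exact P.antisymm _ _

theorem br_trace_trace (X Y : Matrix (Fin N) (Fin N) A) :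
    P.br X.trace Y.trace = (matBr P X Y).trace := by
  simp [trace, P.sum_left, P.sum_right, matBr, Fintype.sum_prod_type]

theorem matBr_mul_right (X Y Z : Matrix (Fin N) (Fin N) A) :
    matBr P X (Y * Z) = matBr P X Y * kronRight Z + kronRight Y * matBr P X Z := by
  ext p q
  rw [Matrix.add_apply, mul_kronRight_apply, kronRight_mul_apply, ← Finset.sum_add_distrib]
  simp only [matBr, mul_apply, P.sum_right, P.leibniz]

theorem matBr_mul_left (X Y Z : Matrix (Fin N) (Fin N) A) :
    matBr P (X * Y) Z = matBr P X Z * kronLeft Y + kronLeft X * matBr P Y Z := by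
  ext p q
  rw [Matrix.add_apply, mul_kronLeft_apply, kronLeft_mul_apply, ← Finset.sum_add_distrib]
  simp only [matBr, mul_apply, P.sum_left, P.mul_left]

theorem matBr_one_right (X : Matrix (Fin N) (Fin N) A) : matBr P X 1 = 0 := by
  ext p q
  simp only [matBr, one_apply]
  split_ifs <;> simp [P.one_right, P.zero_right]

theorem matBr_one_left (X : Matrix (Fin N) (Fin N) A) : matBr P 1 X = 0 := by
  ext p q
  simp only [matBr, one_apply]
  split_ifs <;> simp [P.one_left, P.zero_left]

theorem matBr_pow_right (X Y : Matrix (Fin N) (Fin N) A) (n : ℕ) :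
    matBr P X (Y ^ n) = conjSum n (kronRight Y) (matBr P X Y) := by
  induction n with
  | zero => rw [pow_zero, matBr_one_right, conjSum_zero]
  | succ n ih => rw [pow_succ, matBr_mul_right, ih, conjSum_succ, map_pow]

theorem matBr_pow_left (X Y : Matrix (Fin N) (Fin N) A) (n : ℕ) :
    matBr P (X ^ n) Y = conjSum n (kronLeft X) (matBr P X Y) := by
  induction n with
  | zero => rw [pow_zero, matBr_one_left, conjSum_zero]
  | succ n ih => rw [pow_succ, matBr_mul_left, ih, conjSum_succ, map_pow]

theorem mComm_mul_kronRight_kronLeft (Q : Matrix (Fin N × Fin N) (Fin N × Fin N) A)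
    (X Y : Matrix (Fin N) (Fin N) A) :
    mComm (Q * kronRight Y) (kronLeft X) = mComm Q (kronLeft X) * kronRight Y := by
  rw [mComm, mComm, sub_mul, mul_assoc, ← (commute_kronLeft_kronRight X Y).eq]
  simp only [mul_assoc]

theorem conjSum_mComm_kronLeft (n : ℕ) (Q : Matrix (Fin N × Fin N) (Fin N × Fin N) A)
    (X Y : Matrix (Fin N) (Fin N) A) :
    conjSum n (kronRight Y) (mComm Q (kronLeft X)) =
      mComm (conjSum n (kronRight Y) Q) (kronLeft X) :=
  conjSum_commutator_of_commute (commute_kronLeft_kronRight X Y).symm n Q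

theorem conjSum_mComm_self (n : ℕ) (X Q : Matrix (Fin N × Fin N) (Fin N × Fin N) A) :
    conjSum n X (mComm Q X) = mComm Q (X ^ n) :=
  conjSum_commutator_self n X Q

theorem trace_conjSum_kronLeft_mul (n : ℕ) (L F : Matrix (Fin N) (Fin N) A)
    (Q : Matrix (Fin N × Fin N) (Fin N × Fin N) A) :
    (conjSum n (kronLeft L) Q * kronLeft F).trace =
      ∑ k ∈ Finset.range n, (kronLeft (L ^ (n - 1 - k) * F * L ^ k) * Q).trace := by
  rw [conjSum, Finset.sum_mul, trace_sum]
  refine Finset.sum_congr rfl fun k _ => ?_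
  rw [mul_assoc, mul_assoc, trace_mul_comm, mul_assoc, trace_mul_comm]
  simp only [map_mul, map_pow, mul_assoc]

/-- Brackets of the traces `Tr(L^n F)` and `Tr(L^m G)`: the `R`-dependent terms cancel. -/
theorem br_trace_pow_mul {L F G : Matrix (Fin N) (Fin N) A}
    {R : Matrix (Fin N × Fin N) (Fin N × Fin N) A}
    (hLL : matBr P L L = mComm R (kronLeft L) - mComm (piSwap R) (kronRight L))
    (hLF : matBr P L F = -mComm (piSwap R) (kronRight F) + mComm casC (kronRight F))
    (hLG : matBr P L G = -mComm (piSwap R) (kronRight G) + mComm casC (kronRight G))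
    (n m : ℕ) :
    P.br (L ^ n * F).trace (L ^ m * G).trace =
      (kronLeft (L ^ n) * (kronRight (L ^ m) * matBr P F G)).trace +
      (∑ k ∈ Finset.range n,
        ((L ^ (n - 1 - k) * F * L ^ k * (G * L ^ m)).trace -
          (L ^ (n - 1 - k) * F * L ^ k * (L ^ m * G)).trace)) +
      ∑ l ∈ Finset.range m,
        ((L ^ n * (F * (L ^ (m - 1 - l) * G * L ^ l))).trace -
          (F * (L ^ n * (L ^ (m - 1 - l) * G * L ^ l))).trace) := by
  set S := conjSum m (kronRight L) R * kronRight G with hS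
  set T := conjSum m (kronRight L) casC * kronRight G with hT
  have hFL : matBr P F L = mComm R (kronLeft F) - mComm casC (kronLeft F) := by
    have h : matBr P F L = piSwap (mComm (piSwap R) (kronRight F)) -
        piSwap (mComm casC (kronRight F)) := by
      rw [matBr_eq_neg_piSwap, hLF]
      ext p q
      simp [piSwap, neg_add_eq_sub]
    rw [h, piSwap_mComm, piSwap_mComm, piSwap_piSwap, piSwap_casC, piSwap_kronRight]
  have hL : matBr P L (L ^ m * G) = mComm S (kronLeft L) -
      mComm (piSwap R) (kronRight (L ^ m * G)) +
      kronRight (L ^ m) * mComm casC (kronRight G) := by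
    rw [matBr_mul_right, matBr_pow_right, hLL, hLG, conjSum_sub, conjSum_mComm_kronLeft,
      conjSum_mComm_self, hS, mComm_mul_kronRight_kronLeft, map_mul, map_pow]
    simp only [mComm]
    noncomm_ring
  have hF : matBr P F (L ^ m * G) = mComm S (kronLeft F) - mComm T (kronLeft F) +
      kronRight (L ^ m) * matBr P F G := by
    rw [matBr_mul_right, matBr_pow_right, hFL, conjSum_sub, conjSum_mComm_kronLeft,
      conjSum_mComm_kronLeft, hS, hT, mComm_mul_kronRight_kronLeft,
      mComm_mul_kronRight_kronLeft, sub_mul]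
  have hTtr : (kronLeft (L ^ n) * mComm T (kronLeft F)).trace =
      ∑ l ∈ Finset.range m,
        ((F * (L ^ n * (L ^ (m - 1 - l) * G * L ^ l))).trace -
          (L ^ n * (F * (L ^ (m - 1 - l) * G * L ^ l))).trace) := by
    rw [hT, mComm_mul_kronRight_kronLeft, ← conjSum_mComm_kronLeft, conjSum, Finset.sum_mul,
      Finset.mul_sum, trace_sum]
    refine Finset.sum_congr rfl fun l _ => ?_
    rw [← trace_mul_mComm_casC_kronLeft]
    have h := (commute_kronLeft_kronRight (L ^ n) (L ^ (m - 1 - l) * G)).eq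
    rw [mul_assoc, mul_assoc, ← map_pow, ← map_pow, ← map_mul, ← mul_assoc, ← mul_assoc,
      trace_mul_comm, ← mul_assoc, ← mul_assoc, ← h]
    simp only [map_mul, mul_assoc]
  have hStr : (mComm S (kronLeft L ^ n) * kronLeft F).trace +
      (kronLeft (L ^ n) * mComm S (kronLeft F)).trace = 0 := by
    rw [← trace_add, ← trace_mComm S (kronLeft (L ^ n * F)), map_mul, map_pow]
    congr 1
    simp only [mComm]
    noncomm_ring
  rw [br_trace_trace, matBr_mul_left, matBr_pow_left, hL, hF, conjSum_add, conjSum_sub,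
    conjSum_mComm_self]
  simp only [add_mul, sub_mul, mul_add, mul_sub, trace_add, trace_sub]
  rw [hTtr, trace_conjSum_kronLeft_mul, trace_conjSum_kronLeft_mul]
  simp only [trace_kronLeft_mul_mComm_kronRight, trace_mul_mComm_casC_kronRight,
    Finset.sum_const_zero, Finset.sum_sub_distrib]
  linear_combination hStr

variable {r : ℕ} (ξ η : Fin N → Fin r → A)

theorem trace_mul_Fab (X : Matrix (Fin N) (Fin N) A) (a b : Fin r) :
    (X * Fab ξ η a b).trace = (fun j => η j a) ⬝ᵥ (X *ᵥ fun i => ξ i b) := by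
  have h : Fab ξ η a b = vecMulVec (fun i => ξ i b) fun j => η j a := rfl
  rw [h, mul_vecMulVec, trace_vecMulVec, dotProduct_comm]

theorem trace_mul_Fab_mul_mul_Fab (X Y : Matrix (Fin N) (Fin N) A) (a b c d : Fin r) :
    (X * Fab ξ η a b * Y * Fab ξ η c d).trace =
      (X * Fab ξ η c b).trace * (Y * Fab ξ η a d).trace := by
  have h : Fab ξ η a b = vecMulVec (fun i => ξ i b) fun j => η j a := rfl
  rw [trace_mul_Fab, trace_mul_Fab, trace_mul_Fab, h, mul_assoc, ← mulVec_mulVec,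
    ← mulVec_mulVec, vecMulVec_mulVec]
  simp [mulVec_smul, dotProduct_smul, mul_comm]

theorem trace_mul_Fab_cyclic (X Y Z : Matrix (Fin N) (Fin N) A) (a b c d : Fin r) :
    (X * Fab ξ η a b * Y * (Fab ξ η c d * Z)).trace =
      (Z * X * Fab ξ η c b).trace * (Y * Fab ξ η a d).trace := by
  rw [← mul_assoc, trace_mul_comm, ← trace_mul_Fab_mul_mul_Fab]
  simp only [mul_assoc]

end TensorSquare

theorem statement19 {A : Type*} [CommRing A] {N : ℕ} (P : PoissonBr A)
    {r : ℕ} (hr : 1 ≤ r) (ξ η : Fin N → Fin r → A)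
    (L : Matrix (Fin N) (Fin N) A)
    (R : Matrix (Fin N × Fin N) (Fin N × Fin N) A)
    (hLL : matBr P L L =
      mComm R (L ⊗ₖ (1 : Matrix (Fin N) (Fin N) A)) -
        mComm (piSwap R) ((1 : Matrix (Fin N) (Fin N) A) ⊗ₖ L))
    (hLF : ∀ a b, matBr P L (Fab ξ η a b) =
      -mComm (piSwap R) ((1 : Matrix (Fin N) (Fin N) A) ⊗ₖ Fab ξ η a b) +
        mComm casC ((1 : Matrix (Fin N) (Fin N) A) ⊗ₖ Fab ξ η a b))
    (hFF : ∀ a b c d, matBr P (Fab ξ η a b) (Fab ξ η c d) =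
      ((if a = d then (1 : A) else 0) •
          ((Fab ξ η c b) ⊗ₖ (1 : Matrix (Fin N) (Fin N) A)) -
        (if c = b then (1 : A) else 0) •
          ((1 : Matrix (Fin N) (Fin N) A) ⊗ₖ Fab ξ η a d)) * casC) :
    ∀ (n m : ℕ) (a b c d : Fin r),
      P.br ((L ^ n * Fab ξ η a b).trace) ((L ^ m * Fab ξ η c d).trace) =
        (if a = d then (1 : A) else 0) * (L ^ (n + m) * Fab ξ η c b).trace -
          (if c = b then (1 : A) else 0) * (L ^ (n + m) * Fab ξ η a d).trace +
        (∑ i ∈ Finset.Icc 1 n,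
          ((L ^ (n + m - i) * Fab ξ η c b).trace * (L ^ (i - 1) * Fab ξ η a d).trace -
            (L ^ (n - i) * Fab ξ η c b).trace * (L ^ (m + i - 1) * Fab ξ η a d).trace)) +
        (∑ i ∈ Finset.Icc 1 m,
          ((L ^ (n + i - 1) * Fab ξ η c b).trace * (L ^ (m - i) * Fab ξ η a d).trace -
            (L ^ (i - 1) * Fab ξ η c b).trace * (L ^ (m + n - i) * Fab ξ η a d).trace)) := by
  intro n m a b c d
  rw [br_trace_pow_mul P hLL (hLF a b) (hLF c d), hFF, sum_Icc_one_eq_sum_range,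
    sum_Icc_one_eq_sum_range]
  congr 1
  · congr 1
    · rw [← kronLeft_apply, ← kronRight_apply, sub_mul, mul_sub, mul_sub, trace_sub]
      simp only [smul_mul_assoc, mul_smul_comm, trace_smul, smul_eq_mul]
      rw [← mul_assoc (kronRight _) (kronLeft _), ← (commute_kronLeft_kronRight _ _).eq,
        mul_assoc (kronLeft _) (kronRight _), ← mul_assoc (kronLeft _) (kronLeft _),
        ← mul_assoc (kronRight _) (kronRight _), ← map_mul, ← map_mul,
        trace_kronLeft_mul_kronRight_mul_casC, trace_kronLeft_mul_kronRight_mul_casC,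
        trace_mul_comm (_ * _) (L ^ m), ← mul_assoc, ← mul_assoc, ← pow_add, ← pow_add,
        add_comm m n]
    · refine Finset.sum_congr rfl fun k hk => ?_
      have hk := Finset.mem_range.1 hk
      rw [trace_mul_Fab_cyclic, ← mul_assoc, mul_assoc _ (L ^ k),
        trace_mul_Fab_mul_mul_Fab, ← pow_add, ← pow_add,
        show m + (n - 1 - k) = n + m - (k + 1) by omega, show n - 1 - k = n - (k + 1) by omega,
        show k + m = m + (k + 1) - 1 by omega, Nat.add_sub_cancel]
  · refine Finset.sum_congr rfl fun l hl => ?_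
    have hl := Finset.mem_range.1 hl
    have h₁ := trace_mul_Fab_cyclic ξ η (L ^ n) (L ^ (m - 1 - l)) (L ^ l) a b c d
    have h₂ := trace_mul_Fab_cyclic ξ η 1 (L ^ n * L ^ (m - 1 - l)) (L ^ l) a b c d
    simp only [mul_assoc, one_mul] at h₁ h₂ ⊢
    rw [h₁, h₂]
    simp only [← mul_assoc, ← pow_add]
    rw [show l + n = n + (l + 1) - 1 by omega, show m - 1 - l = m - (l + 1) by omega,
      show n + (m - (l + 1)) = m + n - (l + 1) by omega, Nat.add_sub_cancel]
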